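/- There exists a linear code over the field with 8 elements of block length 49, dimension 13, and minimum distance at least 27; that is, there is an F₈-linear subspace C of the space of functions from a 49-element index set to F₈ with dim C = 13 such that every nonzero element of C has Hamming weight at least 27. -/

import Mathlib

/-- `F8` is the finite field with 8 elements, `GF(2,3)`. -/
abbrev F8 : Type := GaloisField 2 3

/-- The Hamming weight of a vector `c : Fin 49 → F8`: the number of
coordinates at which `c` is nonzero. -/
noncomputable def hammingWeight (c : Fin 49 → F8) : ℕ :=
  Nat.card {i : Fin 49 // c i ≠ 0}

namespace Toric

/-- powers of the generator `w` (`w^3 = w + 1`), elements written as bit triples -/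
def ex (k : ℕ) : ℕ := [1, 2, 4, 3, 6, 7, 5].getD (k % 7) 0

/-- multiplication by `w` -/
def xt (g : ℕ) : ℕ := ((2 * g) % 8) ^^^ (cond (g.testBit 2) 3 0)

/-- first exponent attached to the second exponent `j` -/
def piv (j : ℕ) : ℕ := [1, 2, 5, 2, 0, 6, 2].getD j 0

/-- the six remaining exponent pairs -/
def ri (k : ℕ) : ℕ := [4, 6, 5, 4, 2, 6].getD k 0
def rj (k : ℕ) : ℕ := [0, 0, 1, 3, 4, 6].getD k 0

def mulF (c g : ℕ) : ℕ :=
  (cond (c.testBit 0) g 0) ^^^ ((cond (c.testBit 1) (xt g) 0) ^^^ (cond (c.testBit 2) (xt (xt g)) 0))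

def gF (x y : ℕ) : ℕ :=
  (List.range 7).foldr (fun j r => ex (piv j * x + j * y) ^^^ r) 0

def dF (x y k : ℕ) : ℕ :=
  ex (ri k * x + rj k * y) ^^^ ex (piv (rj k) * x + rj k * y)

/-- all-ones vector with `2^n` entries -/
def ones (n : ℕ) : ℕ := Nat.sub (Nat.pow 2 (Nat.pow 2 n)) 1

/-- bit vector of all values of a linear form over the field with two elements -/
def lin : List Bool → ℕ
  | [] => 0
  | b :: bs => Nat.lor (lin bs)
      (Nat.shiftLeft (Nat.xor (lin bs) (cond b (ones bs.length) 0)) (Nat.pow 2 bs.length))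

def trow (p : ℕ) : List ℕ :=
  (List.range 6).flatMap fun k =>
    [dF (p / 7) (p % 7) k, xt (dF (p / 7) (p % 7) k), xt (xt (dF (p / 7) (p % 7) k))]

def plane (p s : ℕ) : ℕ := lin ((trow p).map fun n => n.testBit s)

def nz (c s : ℕ) : ℕ := cond (c.testBit s) 0 (ones 18)

def ind (p c : ℕ) : ℕ :=
  Nat.land (Nat.xor (plane p 0) (nz c 0))
    (Nat.land (Nat.xor (plane p 1) (nz c 1)) (Nat.xor (plane p 2) (nz c 2)))

def gT (x y : ℕ) : ℕ :=
  Nat.mod (Nat.shiftRight 88637916734388279040982038441532575962890241 (Nat.mul 3 (Nat.add (Nat.mul 7 x) (Nat.mod y 7)))) 8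
def mulT (c g : ℕ) : ℕ :=
  Nat.mod (Nat.shiftRight 2821848294356612419217921029917578219971947684264937521152 (Nat.mul 3 (Nat.add (Nat.mul 8 c) g))) 8

def cval (us : List (ℕ × ℕ)) (p : ℕ) : ℕ :=
  us.foldr (fun u r => Nat.xor (mulT u.2 (gT (Nat.div p 7) (Nat.sub (Nat.add p 7) u.1))) r) 0

def run (us : List (ℕ × ℕ)) : List ℕ → ℕ → ℕ → ℕ → ℕ → ℕ → ℕ → Bool
  | [], _, _, _, _, _, _ => true
  | p :: ps, c0, c1, c2, c3, c4, c5 =>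
    let b := ind p (cval us p)
    let k0 := Nat.land c0 b
    let k1 := Nat.land c1 k0
    let k2 := Nat.land c2 k1
    let k3 := Nat.land c3 k2
    let k4 := Nat.land c4 k3
    cond (Nat.beq (Nat.land c5 k4) 0)
      (run us ps (Nat.xor c0 b) (Nat.xor c1 k0) (Nat.xor c2 k1) (Nat.xor c3 k2) (Nat.xor c4 k3)
        (Nat.xor c5 k4)) false

def positions : List ℕ :=
  [0, 1, 2, 3, 4, 5, 6, 7, 8, 9, 10, 11, 12, 13, 14, 15, 16, 17, 18, 19, 20, 21, 22, 23, 24,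
   25, 26, 27, 28, 29, 30, 31, 32, 33, 34, 35, 36, 37, 38, 39, 40, 41, 42, 43, 44, 45, 46, 47, 48]

def check (us : List (ℕ × ℕ)) (m : ℕ) : Bool := run us positions m 0 0 m 0 m

def check8 (d1 d2 c1 : ℕ) : Bool :=
  [0, 1, 2, 3, 4, 5, 6, 7].all fun c2 => check [(0, 1), (d1, c1), (d2, c2)] (ones 18)

/-! ### Soundness of the bit-vector computation -/

/-- value of a linear form -/
def ev : List Bool → List Bool → Bool
  | b :: bs, v :: vs => ((b && v) ^^ ev bs vs)
  | _, _ => false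

/-- position of a bit list in the bit vector -/
def idx : List Bool → ℕ
  | [] => 0
  | v :: vs => (cond v (2 ^ vs.length) 0) + idx vs

lemma idx_lt (vs : List Bool) : idx vs < 2 ^ vs.length := by
  induction vs with
  | nil => simp [idx]
  | cons v vs ih =>
    cases v <;> simp [idx, pow_succ] <;> omega

lemma idx_eq_zero (vs : List Bool) (h : idx vs = 0) : ∀ v ∈ vs, v = false := by
  induction vs with
  | nil => simp
  | cons v vs ih =>
    cases v
    · simp only [idx, cond_false, zero_add] at h
      intro w hw
      rcases List.mem_cons.1 hw with rfl | hw
      · rfl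
      · exact ih h w hw
    · simp only [idx, cond_true] at h
      have : 0 < 2 ^ vs.length := by positivity
      omega

lemma ones_eq (n : ℕ) : ones n = 2 ^ (2 ^ n) - 1 := rfl

lemma testBit_ones (n t : ℕ) : (ones n).testBit t = decide (t < 2 ^ n) := by
  rw [ones_eq, Nat.testBit_two_pow_sub_one]

lemma lin_lt (bs : List Bool) : lin bs < 2 ^ (2 ^ bs.length) := by
  induction bs with
  | nil => simp [lin]
  | cons b bs ih =>
    have h1 : (lin bs ^^^ (cond b (ones bs.length) 0)) < 2 ^ (2 ^ bs.length) := by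
      apply Nat.xor_lt_two_pow ih
      cases b
      · simp
      · simp [ones_eq]
    show (lin bs ||| ((lin bs ^^^ (cond b (ones bs.length) 0)) <<< (2 ^ bs.length))) < _
    have e : 2 ^ (b :: bs).length = 2 ^ bs.length + 2 ^ bs.length := by
      simp [pow_succ]; ring
    rw [e]
    apply Nat.or_lt_two_pow
    · exact ih.trans_le (Nat.pow_le_pow_right (by norm_num) (Nat.le_add_right _ _))
    · rw [Nat.shiftLeft_eq, pow_add]
      exact Nat.mul_lt_mul_of_pos_right h1 (by positivity)

lemma lin_spec (bs vs : List Bool) (h : bs.length = vs.length) :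
    (lin bs).testBit (idx vs) = ev bs vs := by
  induction bs generalizing vs with
  | nil => 
    cases vs
    · simp [lin, ev]
    · simp at h
  | cons b bs ih =>
    cases vs with
    | nil => simp at h
    | cons v vs =>
      have h' : bs.length = vs.length := by simpa using h
      have hi := ih vs h'
      have hl := idx_lt vs
      have hlt := lin_lt bs
      show (lin bs ||| ((lin bs ^^^ (cond b (ones bs.length) 0)) <<< (2 ^ bs.length))).testBit _ = _
      rw [Nat.testBit_or, Nat.testBit_shiftLeft, Nat.testBit_xor]
      cases v
      · simp only [idx, cond_false, zero_add, ev, Bool.and_false, Bool.false_xor, hi]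
        rw [h']
        have : ¬ (2 ^ vs.length ≤ idx vs) := by omega
        simp [this]
      · have h0 : (lin bs).testBit (2 ^ vs.length + idx vs) = false := by
          apply Nat.testBit_lt_two_pow
          rw [h'] at hlt
          exact hlt.trans_le (Nat.pow_le_pow_right (by norm_num) (by omega))
        simp only [idx, cond_true, ev, Bool.and_true, h0, Bool.false_or]
        rw [h']
        simp only [Nat.add_sub_cancel_left, hi]
        cases b
        · simp
        · simp [testBit_ones, hl]

lemma nz_spec (c s t : ℕ) (ht : t < 2 ^ 18) : (nz c s).testBit t = !(c.testBit s) := by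
  unfold nz
  cases c.testBit s
  · rw [cond_false, testBit_ones]; simp only [ht]; rfl
  · simp

lemma trow_length (p : ℕ) : (trow p).length = 18 := by
  simp [trow]

lemma plane_spec (p s : ℕ) (vs : List Bool) (h : vs.length = 18) :
    (plane p s).testBit (idx vs) = ev ((trow p).map fun n => n.testBit s) vs := by
  unfold plane
  exact lin_spec _ _ (by rw [List.length_map, trow_length, h])

lemma ind_spec (p c : ℕ) (vs : List Bool) (h : vs.length = 18)
    (hs : ∀ s < 3, ev ((trow p).map fun n => n.testBit s) vs = c.testBit s) :
    (ind p c).testBit (idx vs) = true := by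
  have ht : idx vs < 2 ^ 18 := by have := idx_lt vs; rwa [h] at this
  show ((plane p 0 ^^^ nz c 0) &&& ((plane p 1 ^^^ nz c 1) &&& (plane p 2 ^^^ nz c 2))).testBit _ = _
  simp only [Nat.testBit_and, Nat.testBit_xor, plane_spec p _ vs h, nz_spec _ _ _ ht,
    hs 0 (by norm_num), hs 1 (by norm_num), hs 2 (by norm_num)]
  cases c.testBit 0 <;> cases c.testBit 1 <;> cases c.testBit 2 <;> rfl

def bt (n t : ℕ) : ℕ := (n.testBit t).toNat

lemma add_step (c0 c1 c2 c3 c4 c5 b : Bool) (h : (c5 && (c4 && (c3 && (c2 && (c1 && (c0 && b)))))) = false) :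
    c0.toNat + 2 * c1.toNat + 4 * c2.toNat + 8 * c3.toNat + 16 * c4.toNat + 32 * c5.toNat + b.toNat
    = (c0 ^^ b).toNat + 2 * (c1 ^^ (c0 && b)).toNat + 4 * (c2 ^^ (c1 && (c0 && b))).toNat
      + 8 * (c3 ^^ (c2 && (c1 && (c0 && b)))).toNat
      + 16 * (c4 ^^ (c3 && (c2 && (c1 && (c0 && b))))).toNat
      + 32 * (c5 ^^ (c4 && (c3 && (c2 && (c1 && (c0 && b)))))).toNat := by
  revert h
  revert c0 c1 c2 c3 c4 c5 b
  decide

lemma run_spec (us : List (ℕ × ℕ)) (ps : List ℕ) (t : ℕ) (c0 c1 c2 c3 c4 c5 : ℕ)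
    (h : run us ps c0 c1 c2 c3 c4 c5 = true) :
    bt c0 t + 2 * bt c1 t + 4 * bt c2 t + 8 * bt c3 t + 16 * bt c4 t + 32 * bt c5 t
      + (ps.map fun p => bt (ind p (cval us p)) t).sum < 64 := by
  induction ps generalizing c0 c1 c2 c3 c4 c5 with
  | nil =>
    simp only [List.map_nil, List.sum_nil, bt]
    have := Bool.toNat_le (c0.testBit t)
    have := Bool.toNat_le (c1.testBit t)
    have := Bool.toNat_le (c2.testBit t)
    have := Bool.toNat_le (c3.testBit t)
    have := Bool.toNat_le (c4.testBit t)
    have := Bool.toNat_le (c5.testBit t)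
    omega
  | cons p ps ih =>
    rw [run] at h
    generalize hb : ind p (cval us p) = b at h
    have h0 : Nat.beq (Nat.land c5 (Nat.land c4 (Nat.land c3 (Nat.land c2 (Nat.land c1 (Nat.land c0 b)))))) 0 = true := by
      by_contra hc
      rw [Bool.not_eq_true] at hc
      simp only [hc, cond_false] at h
      exact absurd h (by decide)
    simp only [h0, cond_true] at h
    have := ih _ _ _ _ _ _ h
    rw [List.map_cons, List.sum_cons, hb]
    have hz : c5 &&& (c4 &&& (c3 &&& (c2 &&& (c1 &&& (c0 &&& b))))) = 0 := Nat.eq_of_beq_eq_true h0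
    have hz' := congrArg (fun n => n.testBit t) hz
    simp only [Nat.testBit_and, Nat.zero_testBit] at hz'
    have key := add_step _ _ _ _ _ _ _ hz'
    have this' : bt (c0 ^^^ b) t + 2 * bt (c1 ^^^ (c0 &&& b)) t + 4 * bt (c2 ^^^ (c1 &&& (c0 &&& b))) t
      + 8 * bt (c3 ^^^ (c2 &&& (c1 &&& (c0 &&& b)))) t
      + 16 * bt (c4 ^^^ (c3 &&& (c2 &&& (c1 &&& (c0 &&& b))))) t
      + 32 * bt (c5 ^^^ (c4 &&& (c3 &&& (c2 &&& (c1 &&& (c0 &&& b)))))) t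
      + (ps.map fun p => bt (ind p (cval us p)) t).sum < 64 := this
    simp only [bt, Nat.testBit_and, Nat.testBit_xor] at this' ⊢
    omega

lemma check_spec (us : List (ℕ × ℕ)) (m t : ℕ) (h : check us m = true) (hm : m.testBit t = true) :
    (positions.map fun p => bt (ind p (cval us p)) t).sum < 23 := by
  have := run_spec us positions t m 0 0 m 0 m h
  simp only [bt, hm, Nat.zero_testBit] at this
  simp only [Bool.toNat_true, Bool.toNat_false] at this
  unfold bt
  omega

/-! ### The field with eight elements -/

lemma two_eq_zero : (2 : F8) = 0 := by
  have := CharP.cast_eq_zero F8 2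
  exact_mod_cast this

lemma exists_w : ∃ w : F8, w ^ 3 = w + 1 := by
  have h2 := two_eq_zero
  have hc : Nat.card F8 = 8 := by
    have := GaloisField.card 2 3 (by norm_num)
    norm_num at this; exact this
  have : Finite F8 := Nat.finite_of_card_ne_zero (by omega)
  classical
  let _ := Fintype.ofFinite F8
  have hc' : Fintype.card F8 = 8 := by rw [← Nat.card_eq_fintype_card]; exact hc
  obtain ⟨g, hg⟩ : ∃ g : F8, g ∉ ({0, 1} : Finset F8) := by
    by_contra hcon
    push Not at hcon
    have h1 : (Finset.univ : Finset F8) ⊆ {0, 1} := fun x _ => hcon x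
    have := Finset.card_le_card h1
    have h3 : ({0, 1} : Finset F8).card ≤ 2 := Finset.card_le_two
    rw [Finset.card_univ, hc'] at this
    omega
  simp only [Finset.mem_insert, Finset.mem_singleton, not_or] at hg
  obtain ⟨g0, g1⟩ := hg
  have h7 : g ^ 7 = 1 := by
    have := FiniteField.pow_card_sub_one_eq_one g g0
    rwa [hc'] at this
  have hf : (g - 1) * ((g ^ 3 - g - 1) * (g ^ 3 - g ^ 2 - 1)) = 0 := by
    linear_combination h7 + (-g ^ 6 + g ^ 3) * h2
  rcases mul_eq_zero.1 hf with h | h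
  · exact absurd (sub_eq_zero.1 h) g1
  rcases mul_eq_zero.1 h with h | h
  · exact ⟨g, by linear_combination h⟩
  · refine ⟨g⁻¹, ?_⟩
    field_simp
    linear_combination (-1 : F8) * h - g ^ 2 * h2

noncomputable def bb (b : Bool) : F8 := cond b 1 0

lemma bb_xor (a b : Bool) : bb (a ^^ b) = bb a + bb b := by
  have := two_eq_zero
  cases a <;> cases b <;> simp [bb]
  linear_combination -this

lemma bb_and (a b : Bool) : bb (a && b) = bb a * bb b := by
  cases a <;> cases b <;> simp [bb]

noncomputable def phi (w : F8) (n : ℕ) : F8 := bb (n.testBit 0) + bb (n.testBit 1) * w + bb (n.testBit 2) * w ^ 2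

lemma w7 {w : F8} (hw : w ^ 3 = w + 1) : w ^ 7 = 1 := by
  linear_combination (w ^ 4 + w ^ 2 + w + 1) * hw + (w ^ 2 + w) * two_eq_zero

lemma w0 {w : F8} (hw : w ^ 3 = w + 1) : w ≠ 0 := by
  rintro rfl
  simp at hw

lemma w_mod {w : F8} (hw : w ^ 3 = w + 1) (k : ℕ) : w ^ (k % 7) = w ^ k := by
  conv_rhs => rw [← Nat.div_add_mod k 7, pow_add, pow_mul, w7 hw, one_pow, one_mul]

lemma w_congr {w : F8} (hw : w ^ 3 = w + 1) {a b : ℕ} (h : a % 7 = b % 7) : w ^ a = w ^ b := by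
  rw [← w_mod hw a, ← w_mod hw b, h]


lemma phi_xor (w : F8) (a b : ℕ) : phi w (a ^^^ b) = phi w a + phi w b := by
  simp only [phi, Nat.testBit_xor, bb_xor]
  ring

lemma phi_zero (w : F8) : phi w 0 = 0 := by simp [phi, bb]

lemma phi_one (w : F8) : phi w 1 = 1 := by
  have h1 : Nat.testBit 1 1 = false := by decide
  have h2 : Nat.testBit 1 2 = false := by decide
  simp [phi, bb, h1, h2]

lemma phi_cond (w : F8) (b : Bool) (g : ℕ) : phi w (cond b g 0) = bb b * phi w g := by
  cases b <;> simp [bb, phi_zero]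

lemma phi_xt {w : F8} (hw : w ^ 3 = w + 1) (g : ℕ) : phi w (xt g) = w * phi w g := by
  have h2 := two_eq_zero
  have t0 : ((2 * g) % 8).testBit 0 = false := by simp
  have t1 : ((2 * g) % 8).testBit 1 = g.testBit 0 := by
    rw [show 8 = 2 ^ 3 by norm_num, Nat.testBit_mod_two_pow, mul_comm,
      show g * 2 = g * 2 ^ 1 by norm_num, Nat.testBit_mul_two_pow]; simp
  have t2 : ((2 * g) % 8).testBit 2 = g.testBit 1 := by
    rw [show 8 = 2 ^ 3 by norm_num, Nat.testBit_mod_two_pow, mul_comm,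
      show g * 2 = g * 2 ^ 1 by norm_num, Nat.testBit_mul_two_pow]; simp
  have h3 : phi w 3 = 1 + w := by
    have h0 : Nat.testBit 3 0 = true := by decide
    have h1 : Nat.testBit 3 1 = true := by decide
    have h2 : Nat.testBit 3 2 = false := by decide
    simp only [phi, bb, h0, h1, h2, cond_true, cond_false]; ring
  rw [xt, phi_xor, phi_cond, h3]
  simp only [phi, t0, t1, t2]
  simp only [bb, cond_false]
  linear_combination (-(bif g.testBit 2 then 1 else 0) : F8) * hw

lemma phi_mulF {w : F8} (hw : w ^ 3 = w + 1) (c g : ℕ) :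
    phi w (mulF c g) = phi w c * phi w g := by
  rw [mulF, phi_xor, phi_xor, phi_cond, phi_cond, phi_cond, phi_xt hw, phi_xt hw, phi_xt hw]
  conv_rhs => rw [phi]
  ring

lemma phi_ex {w : F8} (hw : w ^ 3 = w + 1) (k : ℕ) : phi w (ex k) = w ^ k := by
  have h2 := two_eq_zero
  have e : ∀ n, n < 7 → phi w ([1, 2, 4, 3, 6, 7, 5].getD n 0) = w ^ n := by
    have x0 : phi w 1 = w ^ 0 := by rw [phi_one, pow_zero]
    have x1 : phi w 2 = w ^ 1 := (phi_xt hw 1).trans (by rw [x0, ← pow_succ'])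
    have x2 : phi w 4 = w ^ 2 := (phi_xt hw 2).trans (by rw [x1, ← pow_succ'])
    have x3 : phi w 3 = w ^ 3 := (phi_xt hw 4).trans (by rw [x2, ← pow_succ'])
    have x4 : phi w 6 = w ^ 4 := (phi_xt hw 3).trans (by rw [x3, ← pow_succ'])
    have x5 : phi w 7 = w ^ 5 := (phi_xt hw 6).trans (by rw [x4, ← pow_succ'])
    have x6 : phi w 5 = w ^ 6 := (phi_xt hw 7).trans (by rw [x5, ← pow_succ'])
    intro n hn
    interval_cases n
    exacts [x0, x1, x2, x3, x4, x5, x6]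
  rw [ex, e _ (Nat.mod_lt _ (by norm_num)), w_mod hw]

lemma bits_zero {w : F8} (hw : w ^ 3 = w + 1) (a b c : Bool)
    (h : bb a + bb b * w + bb c * w ^ 2 = 0) : a = false ∧ b = false ∧ c = false := by
  have h2 := two_eq_zero
  have hp : ∀ k, w ^ k ≠ 0 := fun k => pow_ne_zero k (w0 hw)
  revert h
  cases a <;> cases b <;> cases c <;> simp only [bb, cond_true, cond_false] <;> intro h
  · simp
  · exact absurd (by linear_combination h) (hp 2)
  · exact absurd (by linear_combination h) (hp 1)
  · exact absurd (by linear_combination h + w * hw) (hp 4)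
  · exact absurd (by linear_combination h) (hp 0)
  · exact absurd (by linear_combination h + (w ^ 3 + w + 1) * hw + w * h2) (hp 6)
  · exact absurd (by linear_combination h + hw) (hp 3)
  · exact absurd (by linear_combination h + (w ^ 2 + 1) * hw) (hp 5)

lemma bits_inj {w : F8} (hw : w ^ 3 = w + 1) (a b c a' b' c' : Bool)
    (h : bb a + bb b * w + bb c * w ^ 2 + (bb a' + bb b' * w + bb c' * w ^ 2) = 0) :
    a = a' ∧ b = b' ∧ c = c' := by
  have := bits_zero hw (a ^^ a') (b ^^ b') (c ^^ c') (by
    simp only [bb_xor]; linear_combination h)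
  revert this
  revert a b c a' b' c'
  simp

lemma phi_surj {w : F8} (hw : w ^ 3 = w + 1) (z : F8) : ∃ n < 8, phi w n = z := by
  have h2 := two_eq_zero
  have hc : Nat.card F8 = 8 := by
    have := GaloisField.card 2 3 (by norm_num)
    norm_num at this; exact this
  have : Finite F8 := Nat.finite_of_card_ne_zero (by omega)
  classical
  let _ := Fintype.ofFinite F8
  have hc' : Fintype.card F8 = 8 := by rw [← Nat.card_eq_fintype_card]; exact hc
  have inj : Function.Injective (fun n : Fin 8 => phi w n) := by
    intro a b hab
    have hab' : phi w a = phi w b := hab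
    have := bits_inj hw _ _ _ _ _ _ (show phi w a + phi w b = 0 by
      rw [hab']; linear_combination (phi w b) * h2)
    revert this
    clear hab hab'
    revert a b
    decide
  have bij := (Fintype.bijective_iff_injective_and_card (fun n : Fin 8 => phi w n)).2
    ⟨inj, by rw [hc', Fintype.card_fin]⟩
  obtain ⟨n, hn⟩ := bij.2 z
  exact ⟨n, n.2, hn⟩

/-- combination of table entries -/
noncomputable def comb (w : F8) : List ℕ → List Bool → F8
  | n :: ns, v :: vs => bb v * phi w n + comb w ns vs
  | _, _ => 0

lemma comb_eq (w : F8) (ns : List ℕ) (vs : List Bool) :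
    comb w ns vs = bb (ev (ns.map fun n => n.testBit 0) vs)
      + bb (ev (ns.map fun n => n.testBit 1) vs) * w
      + bb (ev (ns.map fun n => n.testBit 2) vs) * w ^ 2 := by
  induction ns generalizing vs with
  | nil => simp [comb, ev, bb]
  | cons n ns ih =>
    cases vs with
    | nil => simp [comb, ev, bb]
    | cons v vs =>
      simp only [comb, List.map_cons, ev, bb_xor, bb_and, ih, phi]
      ring

/-! ### The code -/

/-- value of the polynomial with coefficients `P`, `N` at the point `(w^x, w^y)` -/
noncomputable def val (w : F8) (P : Fin 7 → F8) (N : Fin 6 → F8) (x y : ℕ) : F8 :=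
  (∑ j : Fin 7, P j * w ^ (piv j * x + j * y)) + ∑ k : Fin 6, N k * w ^ (ri k * x + rj k * y)

/-- coefficients of the restriction to the line `x = 0` -/
noncomputable def hh (P : Fin 7 → F8) (N : Fin 6 → F8) (j : Fin 7) : F8 :=
  P j + ∑ k : Fin 6, if rj k = j then N k else 0

lemma phi_dF {w : F8} (hw : w ^ 3 = w + 1) (x y k : ℕ) :
    phi w (dF x y k) = w ^ (ri k * x + rj k * y) + w ^ (piv (rj k) * x + rj k * y) := by
  rw [dF, phi_xor, phi_ex hw, phi_ex hw]

lemma val_eq {w : F8} (hw : w ^ 3 = w + 1) (P : Fin 7 → F8) (N : Fin 6 → F8) (x y : ℕ) :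
    val w P N x y = (∑ j : Fin 7, hh P N j * w ^ (piv j * x + j * y))
      + ∑ k : Fin 6, N k * phi w (dF x y k) := by
  have h2 := two_eq_zero
  have key : (∑ j : Fin 7, hh P N j * w ^ (piv j * x + j * y))
      = (∑ j : Fin 7, P j * w ^ (piv j * x + j * y))
        + ∑ k : Fin 6, N k * w ^ (piv (rj k) * x + rj k * y) := by
    simp only [hh, add_mul, Finset.sum_add_distrib, Finset.sum_mul]
    congr 1
    rw [Finset.sum_comm]
    refine Finset.sum_congr rfl fun k _ => ?_
    have hk : rj k < 7 := by revert k; decide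
    rw [Finset.sum_eq_single (⟨rj k, hk⟩ : Fin 7)]
    · simp
    · intro j _ hj
      rw [if_neg, zero_mul]
      intro h
      exact hj (Fin.ext h.symm)
    · simp
  rw [key, val]
  simp only [phi_dF hw, mul_add, Finset.sum_add_distrib]
  linear_combination (-(∑ k : Fin 6, N k * w ^ (piv (rj k) * x + rj k * y))) * h2

lemma val_row {w : F8} (hw : w ^ 3 = w + 1) (P : Fin 7 → F8) (N : Fin 6 → F8) (y : ℕ) :
    val w P N 0 y = ∑ j : Fin 7, hh P N j * w ^ (j * y : ℕ) := by
  have h2 := two_eq_zero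
  rw [val_eq hw]
  simp only [phi_dF hw, mul_zero, zero_add]
  have : ∀ k : Fin 6, N k * (w ^ (rj k * y) + w ^ (rj k * y)) = 0 := fun k => by
    linear_combination (N k * w ^ (rj k * y)) * h2
  simp [this]

lemma w_ne_one {w : F8} (hw : w ^ 3 = w + 1) (m : ℕ) (hm : m % 7 ≠ 0) : w ^ m ≠ 1 := by
  intro h
  have h7 := w7 hw
  have hd : orderOf w ∣ 7 := orderOf_dvd_of_pow_eq_one h7
  have hd' : orderOf w ∣ m := orderOf_dvd_of_pow_eq_one h
  rcases (Nat.dvd_prime (by norm_num)).1 hd with h1 | h1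
  · rw [orderOf_eq_one_iff] at h1
    rw [h1] at hw
    simp at hw
  · rw [h1] at hd'
    omega

lemma sum_w {w : F8} (hw : w ^ 3 = w + 1) (m : ℕ) :
    (∑ b : Fin 7, w ^ (m * b : ℕ)) = if m % 7 = 0 then 1 else 0 := by
  have h2 := two_eq_zero
  have h7 : (w ^ m) ^ 7 = 1 := by rw [← pow_mul, mul_comm, pow_mul, w7 hw, one_pow]
  simp only [pow_mul]
  split_ifs with h
  · have : w ^ m = 1 := by rw [w_congr hw (b := 0) (by simpa using h), pow_zero]
    simp only [this, one_pow, Finset.sum_const, Finset.card_univ, Fintype.card_fin, nsmul_eq_mul]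
    push_cast
    linear_combination 3 * h2
  · have h1 := sub_ne_zero.2 (w_ne_one hw m h)
    apply (mul_eq_zero.1 _).resolve_left h1
    rw [Fin.sum_univ_seven]
    simp only [Fin.val_zero, Fin.val_one, Fin.val_two, Fin.isValue]
    show (w ^ m - 1) * ((w ^ m) ^ 0 + (w ^ m) ^ 1 + (w ^ m) ^ 2 + (w ^ m) ^ 3 + (w ^ m) ^ 4
      + (w ^ m) ^ 5 + (w ^ m) ^ 6) = 0
    linear_combination h7

lemma hh_eq {w : F8} (hw : w ^ 3 = w + 1) (P : Fin 7 → F8) (N : Fin 6 → F8) (j : Fin 7) :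
    hh P N j = ∑ b : Fin 7, val w P N 0 b * w ^ (6 * j * b : ℕ) := by
  simp only [val_row hw, Finset.sum_mul]
  rw [Finset.sum_comm]
  have : ∀ i : Fin 7, (∑ b : Fin 7, hh P N i * w ^ (i * b : ℕ) * w ^ (6 * j * b : ℕ))
      = if i = j then hh P N i else 0 := by
    intro i
    simp only [mul_assoc (hh P N i), ← pow_add, ← add_mul, ← Finset.mul_sum]
    rw [sum_w hw]
    have : (((i : ℕ) + 6 * j) % 7 = 0) ↔ i = j := by revert i j; decide
    simp [this]
  simp [this]

/-- sparse description of a row -/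
noncomputable def rowv (w : F8) (us : List (ℕ × ℕ)) (y : ℕ) : F8 :=
  (us.map fun u => if u.1 = y then phi w u.2 else 0).sum

lemma gT_mod (x y : ℕ) : gT x y = gT x (y % 7) := by
  have h : Nat.mod y 7 = Nat.mod (y % 7) 7 := (Nat.mod_mod y 7).symm
  unfold gT
  rw [h]

lemma gT_eq : ∀ x < 7, ∀ y < 7, gT x y = gF x y := by decide +kernel

lemma mulT_eq : ∀ c < 8, ∀ g < 8, mulT c g = mulF c g := by decide +kernel

lemma gT_lt (x y : ℕ) : gT x y < 8 := Nat.mod_lt _ (by norm_num)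

lemma phi_gF {w : F8} (hw : w ^ 3 = w + 1) (x y : ℕ) :
    phi w (gF x y) = ∑ j : Fin 7, w ^ (piv j * x + j * y) := by
  rw [Fin.sum_univ_seven]
  simp only [gF, List.range, List.range.loop, List.foldr, phi_xor, phi_ex hw, phi_zero]
  simp only [add_assoc, add_zero]
  rfl

lemma phi_gT {w : F8} (hw : w ^ 3 = w + 1) (x y : ℕ) (hx : x < 7) :
    phi w (gT x y) = ∑ j : Fin 7, w ^ (piv j * x + j * y) := by
  rw [gT_mod, gT_eq x hx _ (Nat.mod_lt _ (by norm_num)), phi_gF hw]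
  refine Finset.sum_congr rfl fun j _ => w_congr hw ?_
  simp [Nat.add_mod, Nat.mul_mod]

lemma phi_cval {w : F8} (hw : w ^ 3 = w + 1) (us : List (ℕ × ℕ)) (x y : ℕ)
    (hx : x < 7) (hy : y < 7) (hus : ∀ u ∈ us, u.1 < 7 ∧ u.2 < 8) :
    phi w (cval us (7 * x + y)) =
      ∑ j : Fin 7, (∑ b : Fin 7, rowv w us b * w ^ (6 * j * b : ℕ)) * w ^ (piv j * x + j * y) := by
  induction us with
  | nil => simp [cval, phi_zero, rowv]
  | cons u us ih =>
    have ih' := ih fun v hv => hus v (List.mem_cons_of_mem _ hv)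
    obtain ⟨hu1, hu2⟩ := hus u List.mem_cons_self
    have e : cval (u :: us) (7 * x + y)
        = mulT u.2 (gT ((7 * x + y) / 7) (7 * x + y + 7 - u.1)) ^^^ cval us (7 * x + y) := rfl
    have e2 : ∀ b : ℕ, rowv w (u :: us) b = (if u.1 = b then phi w u.2 else 0) + rowv w us b := by
      intro b; simp [rowv]
    rw [e, phi_xor, ih', mulT_eq _ hu2 _ (gT_lt _ _), phi_mulF hw,
      show (7 * x + y) / 7 = x by omega, phi_gT hw _ _ hx]
    simp only [e2, add_mul, Finset.sum_add_distrib]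
    congr 1
    rw [Finset.mul_sum]
    refine Finset.sum_congr rfl fun j _ => ?_
    rw [Finset.sum_eq_single (⟨u.1, hu1⟩ : Fin 7)]
    · simp only [if_true, mul_assoc]
      rw [← pow_add]
      congr 1
      apply w_congr hw
      have : (7 * x + y + 7 - u.1) = 7 * x + y + 7 - u.1 := rfl
      obtain ⟨d, hd⟩ : ∃ d, 7 * x + y + 7 = d + u.1 := ⟨7 * x + y + 7 - u.1, by omega⟩
      rw [show 7 * x + y + 7 - u.1 = d by omega]
      have h1 : (d : ZMod 7) = (y : ZMod 7) + 6 * (u.1 : ZMod 7) := by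
        have := congrArg (Nat.cast : ℕ → ZMod 7) hd
        push_cast at this
        have h7 : (7 : ZMod 7) = 0 := by decide
        linear_combination -this + (x + 1 - u.1 : ZMod 7) * h7
      change _ ≡ _ [MOD 7]
      rw [← ZMod.natCast_eq_natCast_iff]
      push_cast
      rw [h1]
      ring
    · intro b _ hb
      rw [if_neg, zero_mul]
      intro h
      exact hb (Fin.ext h.symm)
    · simp

/-- bits of the free coefficients -/
def bitsOf (n : Fin 6 → ℕ) : List Bool :=
  [(n 0).testBit 0, (n 0).testBit 1, (n 0).testBit 2, (n 1).testBit 0, (n 1).testBit 1,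
   (n 1).testBit 2, (n 2).testBit 0, (n 2).testBit 1, (n 2).testBit 2, (n 3).testBit 0,
   (n 3).testBit 1, (n 3).testBit 2, (n 4).testBit 0, (n 4).testBit 1, (n 4).testBit 2,
   (n 5).testBit 0, (n 5).testBit 1, (n 5).testBit 2]

lemma comb_bits {w : F8} (hw : w ^ 3 = w + 1) (n : Fin 6 → ℕ) (x y : ℕ) (hy : y < 7) :
    comb w (trow (7 * x + y)) (bitsOf n) = ∑ k : Fin 6, phi w (n k) * phi w (dF x y k) := by
  rw [Fin.sum_univ_six, trow, show (7 * x + y) / 7 = x by omega, show (7 * x + y) % 7 = y by omega]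
  simp only [List.range, List.range.loop, List.flatMap_cons, List.flatMap_nil, List.cons_append,
    List.nil_append, bitsOf, comb, phi_xt hw]
  have e : ∀ k, phi w (n k) = bb ((n k).testBit 0) + bb ((n k).testBit 1) * w
    + bb ((n k).testBit 2) * w ^ 2 := fun _ => rfl
  simp only [e]
  simp only [Fin.val_zero, Fin.val_one, Fin.val_two,
    show ((3 : Fin 6) : ℕ) = 3 from rfl, show ((4 : Fin 6) : ℕ) = 4 from rfl,
    show ((5 : Fin 6) : ℕ) = 5 from rfl]
  ring

open Classical in
/-- number of zeros -/
noncomputable def zeros (w : F8) (P : Fin 7 → F8) (N : Fin 6 → F8) : ℕ :=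
  ∑ x : Fin 7, ∑ y : Fin 7, if val w P N x y = 0 then 1 else 0

lemma sum_positions (f : ℕ → ℕ) :
    (positions.map f).sum = ∑ x : Fin 7, ∑ y : Fin 7, f (7 * x + y) := by
  simp only [Fin.sum_univ_seven, positions, List.map_cons, List.map_nil, List.sum_cons,
    List.sum_nil, add_zero]
  simp only [add_assoc]
  rfl

lemma core {w : F8} (hw : w ^ 3 = w + 1) (P : Fin 7 → F8) (N : Fin 6 → F8)
    (us : List (ℕ × ℕ)) (hus : ∀ u ∈ us, u.1 < 7 ∧ u.2 < 8)
    (n : Fin 6 → ℕ) (hn : ∀ k, phi w (n k) = N k)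
    (hrow : ∀ y : Fin 7, val w P N 0 y = rowv w us y)
    (m : ℕ) (hm : m.testBit (idx (bitsOf n)) = true) (hc : check us m = true) :
    zeros w P N < 23 := by
  refine lt_of_le_of_lt ?_ (check_spec us m _ hc hm)
  rw [sum_positions, zeros]
  refine Finset.sum_le_sum fun x _ => Finset.sum_le_sum fun y _ => ?_
  split_ifs with h
  swap
  · exact Nat.zero_le _
  have hv : phi w (cval us (7 * x + y)) + comb w (trow (7 * x + y)) (bitsOf n) = 0 := by
    rw [← h, val_eq hw, phi_cval hw us x y x.2 y.2 hus, comb_bits hw n x y y.2]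
    simp only [hn, hh_eq hw, hrow]
  rw [comb_eq, phi] at hv
  obtain ⟨h0, h1, h2⟩ := bits_inj hw _ _ _ _ _ _ hv
  unfold bt
  rw [ind_spec _ _ _ rfl]
  · rfl
  · intro s hs
    interval_cases s
    exacts [h0.symm, h1.symm, h2.symm]

/-! ### The computation -/

set_option maxRecDepth 100000

lemma run_zero : check [] (Nat.xor (ones 18) 1) = true := by decide +kernel
lemma run_1_2_0 : check8 1 2 0 = true := by decide +kernel
lemma run_1_2_1 : check8 1 2 1 = true := by decide +kernel
lemma run_1_2_2 : check8 1 2 2 = true := by decide +kernel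
lemma run_1_2_3 : check8 1 2 3 = true := by decide +kernel
lemma run_1_2_4 : check8 1 2 4 = true := by decide +kernel
lemma run_1_2_5 : check8 1 2 5 = true := by decide +kernel
lemma run_1_2_6 : check8 1 2 6 = true := by decide +kernel
lemma run_1_2_7 : check8 1 2 7 = true := by decide +kernel
lemma run_1_3_0 : check8 1 3 0 = true := by decide +kernel
lemma run_1_3_1 : check8 1 3 1 = true := by decide +kernel
lemma run_1_3_2 : check8 1 3 2 = true := by decide +kernel
lemma run_1_3_3 : check8 1 3 3 = true := by decide +kernel
lemma run_1_3_4 : check8 1 3 4 = true := by decide +kernel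
lemma run_1_3_5 : check8 1 3 5 = true := by decide +kernel
lemma run_1_3_6 : check8 1 3 6 = true := by decide +kernel
lemma run_1_3_7 : check8 1 3 7 = true := by decide +kernel
lemma run_1_4_0 : check8 1 4 0 = true := by decide +kernel
lemma run_1_4_1 : check8 1 4 1 = true := by decide +kernel
lemma run_1_4_2 : check8 1 4 2 = true := by decide +kernel
lemma run_1_4_3 : check8 1 4 3 = true := by decide +kernel
lemma run_1_4_4 : check8 1 4 4 = true := by decide +kernel
lemma run_1_4_5 : check8 1 4 5 = true := by decide +kernel
lemma run_1_4_6 : check8 1 4 6 = true := by decide +kernel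
lemma run_1_4_7 : check8 1 4 7 = true := by decide +kernel
lemma run_1_5_0 : check8 1 5 0 = true := by decide +kernel
lemma run_1_5_1 : check8 1 5 1 = true := by decide +kernel
lemma run_1_5_2 : check8 1 5 2 = true := by decide +kernel
lemma run_1_5_3 : check8 1 5 3 = true := by decide +kernel
lemma run_1_5_4 : check8 1 5 4 = true := by decide +kernel
lemma run_1_5_5 : check8 1 5 5 = true := by decide +kernel
lemma run_1_5_6 : check8 1 5 6 = true := by decide +kernel
lemma run_1_5_7 : check8 1 5 7 = true := by decide +kernel
lemma run_2_4_0 : check8 2 4 0 = true := by decide +kernel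
lemma run_2_4_1 : check8 2 4 1 = true := by decide +kernel
lemma run_2_4_2 : check8 2 4 2 = true := by decide +kernel
lemma run_2_4_3 : check8 2 4 3 = true := by decide +kernel
lemma run_2_4_4 : check8 2 4 4 = true := by decide +kernel
lemma run_2_4_5 : check8 2 4 5 = true := by decide +kernel
lemma run_2_4_6 : check8 2 4 6 = true := by decide +kernel
lemma run_2_4_7 : check8 2 4 7 = true := by decide +kernel

def pairs : List (ℕ × ℕ) := [(1, 2), (1, 3), (1, 4), (1, 5), (2, 4)]

lemma run_all (d : ℕ × ℕ) (hd : d ∈ pairs) (c1 c2 : ℕ) (h1 : c1 < 8) (h2 : c2 < 8) :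
    check [(0, 1), (d.1, c1), (d.2, c2)] (ones 18) = true := by
  have h : check8 d.1 d.2 c1 = true := by
    simp only [pairs, List.mem_cons, List.not_mem_nil, or_false] at hd
    rcases hd with rfl | rfl | rfl | rfl | rfl <;> interval_cases c1
    exacts [run_1_2_0, run_1_2_1, run_1_2_2, run_1_2_3, run_1_2_4, run_1_2_5, run_1_2_6, run_1_2_7,
      run_1_3_0, run_1_3_1, run_1_3_2, run_1_3_3, run_1_3_4, run_1_3_5, run_1_3_6, run_1_3_7,
      run_1_4_0, run_1_4_1, run_1_4_2, run_1_4_3, run_1_4_4, run_1_4_5, run_1_4_6, run_1_4_7,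
      run_1_5_0, run_1_5_1, run_1_5_2, run_1_5_3, run_1_5_4, run_1_5_5, run_1_5_6, run_1_5_7,
      run_2_4_0, run_2_4_1, run_2_4_2, run_2_4_3, run_2_4_4, run_2_4_5, run_2_4_6, run_2_4_7]
  rw [check8, List.all_eq_true] at h
  apply h
  interval_cases c2 <;> simp

/-! ### Reduction to the computation -/

noncomputable def shP (w : F8) (s : F8) (x y : ℕ) (P : Fin 7 → F8) : Fin 7 → F8 :=
  fun j => s * (P j * w ^ (piv j * x + j * y))

noncomputable def shN (w : F8) (s : F8) (x y : ℕ) (N : Fin 6 → F8) : Fin 6 → F8 :=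
  fun k => s * (N k * w ^ (ri k * x + rj k * y))

lemma val_shift (w s : F8) (x0 y0 : ℕ) (P : Fin 7 → F8) (N : Fin 6 → F8) (x y : ℕ) :
    val w (shP w s x0 y0 P) (shN w s x0 y0 N) x y = s * val w P N (x0 + x) (y0 + y) := by
  simp only [val, shP, shN, mul_add, Finset.mul_sum]
  congr 1 <;> refine Finset.sum_congr rfl fun j _ => ?_ <;>
  · rw [mul_assoc, mul_assoc, ← pow_add]
    congr 3
    ring

lemma val_mod {w : F8} (hw : w ^ 3 = w + 1) (P : Fin 7 → F8) (N : Fin 6 → F8) (x y : ℕ) :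
    val w P N (x % 7) (y % 7) = val w P N x y := by
  simp only [val]
  congr 1 <;> refine Finset.sum_congr rfl fun j _ => ?_ <;>
  · congr 1
    apply w_congr hw
    simp [Nat.add_mod, Nat.mul_mod]

lemma val_shift_fin {w : F8} (hw : w ^ 3 = w + 1) (s : F8) (x0 y0 : Fin 7) (P : Fin 7 → F8)
    (N : Fin 6 → F8) (x y : Fin 7) :
    val w (shP w s x0 y0 P) (shN w s x0 y0 N) x y
      = s * val w P N (x0 + x : Fin 7) (y0 + y : Fin 7) := by
  rw [val_shift, Fin.val_add, Fin.val_add, val_mod hw]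

lemma zeros_shift {w : F8} (hw : w ^ 3 = w + 1) (s : F8) (hs : s ≠ 0) (x0 y0 : Fin 7)
    (P : Fin 7 → F8) (N : Fin 6 → F8) :
    zeros w (shP w s x0 y0 P) (shN w s x0 y0 N) = zeros w P N := by
  classical
  simp only [zeros, val_shift_fin hw, mul_eq_zero, hs, false_or]
  rw [← Equiv.sum_comp (Equiv.addLeft x0) (fun x : Fin 7 => ∑ y : Fin 7,
    if val w P N x y = 0 then 1 else 0)]
  refine Finset.sum_congr rfl fun x _ => ?_
  exact Equiv.sum_comp (Equiv.addLeft y0) (fun y : Fin 7 =>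
    if val w P N (x0 + x : Fin 7) y = 0 then 1 else 0)

lemma pattern : ∀ A : Finset (Fin 7), 4 ≤ A.card → A ≠ Finset.univ →
    ∃ y0 : Fin 7, y0 ∉ A ∧ ∃ d ∈ pairs, ∀ e : Fin 7, e ≠ 0 → (e : ℕ) ≠ d.1 → (e : ℕ) ≠ d.2 →
      y0 + e ∈ A := by
  decide +kernel

lemma pairs_spec : ∀ d ∈ pairs, 0 < d.1 ∧ d.1 < d.2 ∧ d.2 < 7 := by decide

lemma mask_testBit (n t : ℕ) (h : t < 2 ^ n) (h0 : t ≠ 0) :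
    (Nat.xor (ones n) 1).testBit t = true := by
  have e : Nat.xor (ones n) 1 = ones n ^^^ 1 := rfl
  have h1 : Nat.testBit 1 t = false := by
    rw [← Bool.not_eq_true, Nat.testBit_one_eq_true_iff_self_eq_zero]
    exact h0
  rw [e, Nat.testBit_xor, testBit_ones, h1]
  simp [h]

lemma zeros_lt {w : F8} (hw : w ^ 3 = w + 1) (P : Fin 7 → F8) (N : Fin 6 → F8)
    (h0 : ¬ (P = 0 ∧ N = 0)) : zeros w P N < 23 := by
  classical
  by_contra hcon
  push Not at hcon
  obtain ⟨x0, hx0⟩ : ∃ x0 : Fin 7, 4 ≤ ∑ y : Fin 7, if val w P N x0 y = 0 then 1 else 0 := by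
    by_contra hc
    push Not at hc
    have : zeros w P N ≤ ∑ x : Fin 7, 3 :=
      Finset.sum_le_sum fun x _ => by have := hc x; omega
    simp at this
    omega
  rw [← Finset.card_filter] at hx0
  set A : Finset (Fin 7) := Finset.univ.filter fun y : Fin 7 => val w P N x0 y = 0 with hA
  by_cases hU : A = Finset.univ
  · -- the whole line vanishes
    have hz := zeros_shift hw 1 one_ne_zero x0 0 P N
    have hsh := val_shift_fin hw 1 x0 0 P N
    have hPne : ∀ j, shP w 1 x0 (0 : Fin 7) P j = 0 → P j = 0 := by
      intro j hj
      simpa [shP, w0 hw] using hj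
    have hNne : ∀ j, shN w 1 x0 (0 : Fin 7) N j = 0 → N j = 0 := by
      intro j hj
      simpa [shN, w0 hw] using hj
    generalize shP w 1 x0 (0 : Fin 7) P = P' at *
    generalize shN w 1 x0 (0 : Fin 7) N = N' at *
    have hr : ∀ y : Fin 7, val w P' N' 0 y = 0 := by
      intro y
      have h1 := hsh 0 y
      have h2 : y ∈ A := by rw [hU]; exact Finset.mem_univ _
      rw [hA, Finset.mem_filter] at h2
      rw [zero_add, add_zero, h2.2, mul_zero] at h1
      exact h1
    choose n hn8 hn using fun k => phi_surj hw (N' k)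
    have hlt := core hw P' N' [] (by simp) n hn (fun y => by rw [hr]; simp [rowv])
      (Nat.xor (ones 18) 1) ?_ run_zero
    · omega
    · have hl : idx (bitsOf n) < 2 ^ 18 := idx_lt (bitsOf n)
      have hne : idx (bitsOf n) ≠ 0 := by
        intro hi
        have hb := idx_eq_zero _ hi
        have hN0 : ∀ k, N' k = 0 := by
          intro k
          rw [← hn]
          have hm : ∀ s < 3, (n k).testBit s ∈ bitsOf n := by
            intro s hs
            fin_cases k <;> interval_cases s <;> simp [bitsOf]
          rw [phi, hb _ (hm 0 (by norm_num)), hb _ (hm 1 (by norm_num)), hb _ (hm 2 (by norm_num))]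
          simp [bb]
        have hP0 : ∀ j, P' j = 0 := by
          intro j
          have := hh_eq hw P' N' j
          simpa [hh, hr, hN0] using this
        exact h0 ⟨funext fun j => hPne j (hP0 j), funext fun k => hNne k (hN0 k)⟩
      exact mask_testBit 18 _ hl hne
  · obtain ⟨y0, hy0, d, hd, he⟩ := pattern A hx0 hU
    have hu : val w P N x0 y0 ≠ 0 := by
      intro h
      exact hy0 (by rw [hA, Finset.mem_filter]; exact ⟨Finset.mem_univ _, h⟩)
    set s := (val w P N x0 y0)⁻¹ with hs
    have hs0 : s ≠ 0 := inv_ne_zero hu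
    have hz := zeros_shift hw s hs0 x0 y0 P N
    have hsh := val_shift_fin hw s x0 y0 P N
    generalize shP w s x0 y0 P = P' at *
    generalize shN w s x0 y0 N = N' at *
    have hr0 : val w P' N' 0 0 = 1 := by
      have h1 := hsh 0 0
      rw [add_zero, add_zero, hs, inv_mul_cancel₀ hu] at h1
      exact h1
    have hr : ∀ y : Fin 7, y ≠ 0 → (y : ℕ) ≠ d.1 → (y : ℕ) ≠ d.2 → val w P' N' 0 y = 0 := by
      intro y ha hb hc
      have h1 := hsh 0 y
      have h2 := he y ha hb hc
      rw [hA, Finset.mem_filter] at h2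
      rw [add_zero, h2.2, mul_zero] at h1
      exact h1
    choose n hn8 hn using fun k => phi_surj hw (N' k)
    obtain ⟨c1, hc1, e1⟩ := phi_surj hw (val w P' N' 0 d.1)
    obtain ⟨c2, hc2, e2⟩ := phi_surj hw (val w P' N' 0 d.2)
    have hdd := pairs_spec d hd
    obtain ⟨hd0, hd1, hd2⟩ := hdd
    have hlt := core hw P' N' [(0, 1), (d.1, c1), (d.2, c2)] ?_ n hn ?_ (ones 18) ?_
      (run_all d hd c1 c2 hc1 hc2)
    · omega
    · intro u hu
      simp only [List.mem_cons, List.not_mem_nil, or_false] at hu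
      rcases hu with rfl | rfl | rfl
      · simp
      · exact ⟨by simp only; omega, hc1⟩
      · exact ⟨hd2, hc2⟩
    · intro y
      simp only [rowv, List.map_cons, List.map_nil, List.sum_cons, List.sum_nil, add_zero, e1, e2,
        phi_one]
      by_cases ha : (y : ℕ) = 0
      · rw [ha, if_pos rfl, if_neg (by omega), if_neg (by omega), hr0]; simp
      by_cases hb : (y : ℕ) = d.1
      · rw [hb, if_neg (by omega), if_pos rfl, if_neg (by omega)]; simp
      by_cases hc : (y : ℕ) = d.2
      · rw [hc, if_neg (by omega), if_neg (by omega), if_pos rfl]; simp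
      · rw [if_neg (by omega), if_neg (by omega), if_neg (by omega),
          hr y (fun h => ha (by rw [h]; rfl)) hb hc]
        simp
    · have hl : idx (bitsOf n) < 2 ^ 18 := idx_lt (bitsOf n)
      rw [testBit_ones]
      simp only [hl, decide_true]

/-- the evaluation map -/
noncomputable def evMap (w : F8) : ((Fin 7 → F8) × (Fin 6 → F8)) →ₗ[F8] (Fin 49 → F8) where
  toFun a := fun p => val w a.1 a.2 (p / 7) (p % 7)
  map_add' a b := by
    funext p
    simp only [val, Prod.fst_add, Prod.snd_add, Pi.add_apply, add_mul, Finset.sum_add_distrib]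
    ring
  map_smul' s a := by
    funext p
    simp only [val, Prod.smul_fst, Prod.smul_snd, Pi.smul_apply, smul_eq_mul, mul_add,
      Finset.mul_sum, RingHom.id_apply, mul_assoc]

lemma weight_evMap (w : F8) (a : (Fin 7 → F8) × (Fin 6 → F8)) :
    hammingWeight (evMap w a) + zeros w a.1 a.2 = 49 := by
  classical
  have h1 : hammingWeight (evMap w a)
      = (Finset.univ.filter fun i : Fin 49 => evMap w a i ≠ 0).card := by
    rw [hammingWeight, Nat.card_eq_fintype_card, Fintype.card_subtype]
  have h2 : zeros w a.1 a.2 = (Finset.univ.filter fun i : Fin 49 => evMap w a i = 0).card := by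
    rw [Finset.card_filter, zeros, ← Fintype.sum_prod_type' (f := fun x y : Fin 7 =>
      if val w a.1 a.2 x y = 0 then 1 else 0)]
    refine Fintype.sum_equiv (finProdFinEquiv (m := 7) (n := 7)) _ _ fun q => ?_
    have hq := q.2.2
    have e : evMap w a (finProdFinEquiv (m := 7) (n := 7) q) = val w a.1 a.2 q.1 q.2 := by
      show val w a.1 a.2 (((q.2 : ℕ) + 7 * q.1) / 7) (((q.2 : ℕ) + 7 * q.1) % 7) = _
      rw [show ((q.2 : ℕ) + 7 * q.1) / 7 = q.1 by omega,
        show ((q.2 : ℕ) + 7 * q.1) % 7 = q.2 by omega]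
    rw [e]
  rw [h1, h2, add_comm, Finset.card_filter_add_card_filter_not]
  simp

end Toric

/-- There exists a linear code over `F₈` of block length 49, dimension 13 and
minimum distance at least 27: an `F₈`-linear subspace `C` of the functions from
a 49-element index set to `F₈`, with `dim C = 13`, all of whose nonzero
elements have Hamming weight at least 27. -/
theorem exists_code_49_13_27 :
    ∃ C : Submodule F8 (Fin 49 → F8),
      Module.finrank F8 C = 13 ∧
      ∀ c ∈ C, c ≠ 0 → 27 ≤ hammingWeight c := by
  obtain ⟨w, hw⟩ := Toric.exists_w
  have key : ∀ a, a ≠ 0 → 27 ≤ hammingWeight (Toric.evMap w a) := by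
    intro a ha
    have h1 := Toric.weight_evMap w a
    have h2 := Toric.zeros_lt hw a.1 a.2 (fun h => ha (Prod.ext h.1 h.2))
    omega
  have inj : Function.Injective (Toric.evMap w) := by
    rw [← LinearMap.ker_eq_bot, LinearMap.ker_eq_bot']
    intro a ha
    by_contra hne
    have := key a hne
    rw [ha] at this
    simp [hammingWeight] at this
  refine ⟨LinearMap.range (Toric.evMap w), ?_, ?_⟩
  · rw [LinearMap.finrank_range_of_inj inj]
    simp
  · rintro c ⟨a, rfl⟩ hc
    exact key a (fun h => hc (by rw [h, map_zero]))
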